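/- arXiv:2405.09400 — 2 statements merged into one kernel-verified Lean document; each statement's English description precedes it below -/
import Mathlib

section
/- Let π* be the unique minimizer of the entropic optimal transport problem min_{π∈Π(μ,ν)} ⟨c,π⟩ + ε·KL(π|μ⊗ν). Then there exist measurable functions α*: X→ℝ and β*: Y→ℝ such that π* = exp((α*(x)+β*(y)−c(x,y))/ε)·(μ⊗ν), i.e. π* is absolutely continuous with respect to μ⊗ν with density exp((α*⊕β*−c)/ε). -/
open MeasureTheory Filter Topology
open scoped ENNReal

noncomputable section

/-- `π` is a coupling (transport plan) between `μ` and `ν`. -/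
def IsCoupling {X Y : Type*} [MeasurableSpace X] [MeasurableSpace Y]
    (μ : Measure X) (ν : Measure Y) (π : Measure (X × Y)) : Prop :=
  π.map Prod.fst = μ ∧ π.map Prod.snd = ν

/-- `φ(s) = s·log s − s + 1`; note `Real.log 0 = 0`, so `phiKL 0 = 1` as required. -/
def phiKL (s : ℝ) : ℝ := s * Real.log s - s + 1

/-- Kullback–Leibler divergence `KL(ρ|σ) = ∫ φ(dρ/dσ) dσ` if `ρ ≪ σ`, and `+∞` otherwise. -/
def KL {Z : Type*} [MeasurableSpace Z] (ρ σ : Measure Z) : ℝ≥0∞ :=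
  letI := Classical.propDecidable (ρ ≪ σ)
  if ρ ≪ σ then ∫⁻ z, ENNReal.ofReal (phiKL ((ρ.rnDeriv σ) z).toReal) ∂σ else ⊤

/-- The entropic optimal transport objective `⟨c,π⟩ + ε·KL(π|μ⊗ν)`, valued in `EReal`. -/
def EOT {X Y : Type*} [MeasurableSpace X] [MeasurableSpace Y]
    (c : X × Y → ℝ) (ε : ℝ) (μ : Measure X) (ν : Measure Y)
    (π : Measure (X × Y)) : EReal :=
  ((∫ p, c p ∂π : ℝ) : EReal) + (ε : EReal) * ((KL π (μ.prod ν) : ℝ≥0∞) : EReal)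



section Sinkhorn

variable {X Y : Type*} [MeasurableSpace X] [MeasurableSpace Y]

/-- A measurable function pinched between two positive finite constants. -/
def IsPinched (a : X → ℝ≥0∞) : Prop :=
  Measurable a ∧ ∃ lo hi : ℝ≥0∞, lo ≠ 0 ∧ hi ≠ ⊤ ∧ ∀ x, lo ≤ a x ∧ a x ≤ hi

lemma IsPinched.ne_zero {a : X → ℝ≥0∞} (ha : IsPinched a) (x : X) : a x ≠ 0 := by
  obtain ⟨-, lo, hi, hlo, -, h⟩ := ha
  exact fun h0 => hlo (le_zero_iff.mp (h0 ▸ (h x).1))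

lemma IsPinched.ne_top {a : X → ℝ≥0∞} (ha : IsPinched a) (x : X) : a x ≠ ⊤ := by
  obtain ⟨-, lo, hi, -, hhi, h⟩ := ha
  exact fun h0 => hhi (top_le_iff.mp (h0 ▸ (h x).2))

lemma IsPinched.exists_abs_log_le {a : X → ℝ≥0∞} (ha : IsPinched a) :
    ∃ C, ∀ x, |Real.log (a x).toReal| ≤ C := by
  have ha' := ha
  obtain ⟨-, lo, hi, hlo, hhi, h⟩ := ha
  refine ⟨max (-Real.log lo.toReal) (Real.log hi.toReal), fun x => abs_le'.mpr ⟨?_, ?_⟩⟩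
  · refine le_max_of_le_right (Real.log_le_log ?_ (ENNReal.toReal_mono hhi (h x).2))
    exact ENNReal.toReal_pos (ha'.ne_zero x) (ha'.ne_top x)
  · refine le_max_of_le_left (neg_le_neg (Real.log_le_log ?_
      (ENNReal.toReal_mono (ha'.ne_top x) (h x).1)))
    exact ENNReal.toReal_pos hlo (fun h0 => ha'.ne_top x (top_le_iff.mp (h0 ▸ (h x).1)))

lemma IsPinched.measurable_log {a : X → ℝ≥0∞} (ha : IsPinched a) :
    Measurable fun x => Real.log (a x).toReal :=
  Real.measurable_log.comp ha.1.ennreal_toReal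

lemma IsPinched.integrable_log {μ : Measure X} [IsFiniteMeasure μ] {a : X → ℝ≥0∞}
    (ha : IsPinched a) : Integrable (fun x => Real.log (a x).toReal) μ := by
  obtain ⟨C, hC⟩ := ha.exists_abs_log_le
  exact Integrable.of_bound ha.measurable_log.aestronglyMeasurable C (ae_of_all _ hC)

lemma IsPinched.lintegral_ne_zero {μ : Measure X} [IsProbabilityMeasure μ] {a : X → ℝ≥0∞}
    (ha : IsPinched a) : ∫⁻ x, a x ∂μ ≠ 0 := by
  obtain ⟨-, lo, hi, hlo, -, h⟩ := ha
  have : lo ≤ ∫⁻ x, a x ∂μ := by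
    simpa using lintegral_mono (μ := μ) (fun x => (h x).1)
  exact fun h0 => hlo (le_zero_iff.mp (h0 ▸ this))

lemma IsPinched.lintegral_ne_top {μ : Measure X} [IsProbabilityMeasure μ] {a : X → ℝ≥0∞}
    (ha : IsPinched a) : ∫⁻ x, a x ∂μ ≠ ⊤ := by
  obtain ⟨-, lo, hi, -, hhi, h⟩ := ha
  have : ∫⁻ x, a x ∂μ ≤ hi := by
    simpa using lintegral_mono (μ := μ) (fun x => (h x).2)
  exact ne_top_of_le_ne_top hhi this

lemma IsPinched.integral_log_le {μ : Measure X} [IsProbabilityMeasure μ] {a b : X → ℝ≥0∞}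
    (ha : IsPinched a) (hb : IsPinched b) (hab : ∫⁻ x, a x * (b x)⁻¹ ∂μ = 1) :
    ∫ x, Real.log (a x).toReal ∂μ ≤ ∫ x, Real.log (b x).toReal ∂μ := by
  have hm : Measurable fun x => a x * (b x)⁻¹ := ha.1.mul hb.1.inv
  have hq : Integrable (fun x => (a x * (b x)⁻¹).toReal) μ :=
    integrable_toReal_of_lintegral_ne_top hm.aemeasurable (by simp [hab])
  have hq1 : ∫ x, (a x * (b x)⁻¹).toReal ∂μ = 1 := by
    rw [integral_toReal hm.aemeasurable (ae_of_all _ fun x => ENNReal.mul_lt_top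
      (ha.ne_top x).lt_top (ENNReal.inv_ne_top.mpr (hb.ne_zero x)).lt_top), hab]
    simp
  rw [← sub_nonpos, ← integral_sub ha.integrable_log hb.integrable_log]
  calc ∫ x, (Real.log (a x).toReal - Real.log (b x).toReal) ∂μ
      ≤ ∫ x, ((a x * (b x)⁻¹).toReal - 1) ∂μ := by
        refine integral_mono (ha.integrable_log.sub hb.integrable_log)
          (hq.sub (integrable_const 1)) fun x => ?_
        have h1 := ENNReal.toReal_pos (ha.ne_zero x) (ha.ne_top x)
        have h2 := ENNReal.toReal_pos (hb.ne_zero x) (hb.ne_top x)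
        have := Real.log_le_sub_one_of_pos (div_pos h1 h2)
        rw [Real.log_div h1.ne' h2.ne'] at this
        simpa [ENNReal.toReal_mul, ENNReal.toReal_inv, div_eq_mul_inv] using this
    _ = 0 := by rw [integral_sub hq (integrable_const 1), hq1]; simp

lemma IsPinched.one_le_of_integral_log_nonneg {μ : Measure X} [IsProbabilityMeasure μ]
    {a : X → ℝ≥0∞} (ha : IsPinched a) (h : 0 ≤ ∫ x, Real.log (a x).toReal ∂μ) {C : ℝ≥0∞}
    (hC : ∀ x, a x ≤ C) : 1 ≤ C := by
  by_contra! hlt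
  have hCt : C ≠ ⊤ := (hlt.trans ENNReal.one_lt_top).ne
  obtain ⟨x₀⟩ : Nonempty X := nonempty_of_isProbabilityMeasure μ
  have hC0 : 0 < C.toReal :=
    ENNReal.toReal_pos (fun h0 => ha.ne_zero x₀ (le_zero_iff.mp (h0 ▸ hC x₀))) hCt
  have h1 : ∫ x, Real.log (a x).toReal ∂μ ≤ Real.log C.toReal := by
    simpa using integral_mono (μ := μ) ha.integrable_log (integrable_const (Real.log C.toReal))
      fun x => Real.log_le_log (ENNReal.toReal_pos (ha.ne_zero x) (ha.ne_top x))
        (ENNReal.toReal_mono hCt (hC x))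
  have h2 : Real.log C.toReal < 0 :=
    Real.log_neg hC0 (by simpa using ENNReal.toReal_strict_mono ENNReal.one_ne_top hlt)
  linarith

/-- Half a Sinkhorn iteration: `y ↦ (∫ k(x,y) a(x) dμ(x))⁻¹`. -/
def sinkhornStep (μ : Measure X) (k : X → Y → ℝ≥0∞) (a : X → ℝ≥0∞) (y : Y) : ℝ≥0∞ :=
  (∫⁻ x, k x y * a x ∂μ)⁻¹

lemma inv_lintegral_le_sinkhornStep {Z : Type*} {μ : Measure X} {k : X → Z → ℝ≥0∞}
    {a : X → ℝ≥0∞} (hk1 : ∀ x z, k x z ≤ 1) (y : Z) :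
    (∫⁻ x, a x ∂μ)⁻¹ ≤ sinkhornStep μ k a y :=
  ENNReal.inv_le_inv.mpr (lintegral_mono fun x => mul_le_of_le_one_left' (hk1 x y))

lemma sinkhornStep_le {Z : Type*} {μ : Measure X} {k : X → Z → ℝ≥0∞} {δ : ℝ≥0∞}
    {a : X → ℝ≥0∞} (ha : Measurable a) (hkδ : ∀ x z, δ ≤ k x z) (y : Z) :
    sinkhornStep μ k a y ≤ (δ * ∫⁻ x, a x ∂μ)⁻¹ := by
  refine ENNReal.inv_le_inv.mpr ?_
  rw [← lintegral_const_mul _ ha]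
  exact lintegral_mono fun x => mul_le_mul_left (hkδ x y) _

variable {μ : Measure X} {ν : Measure Y} [IsProbabilityMeasure μ] [IsProbabilityMeasure ν]
  {k : X → Y → ℝ≥0∞} {δ : ℝ≥0∞} {a : X → ℝ≥0∞}

lemma measurable_sinkhornStep (hk : Measurable (Function.uncurry k)) (ha : Measurable a) :
    Measurable (sinkhornStep μ k a) :=
  (Measurable.lintegral_prod_left' (f := fun p : X × Y => k p.1 p.2 * a p.1)
    (hk.mul (ha.comp measurable_fst))).inv

lemma IsPinched.sinkhornStep (hk : Measurable (Function.uncurry k)) (hδ : δ ≠ 0)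
    (hkδ : ∀ x y, δ ≤ k x y) (hk1 : ∀ x y, k x y ≤ 1) (ha : IsPinched a) :
    IsPinched (sinkhornStep μ k a) :=
  ⟨measurable_sinkhornStep hk ha.1, _, _, ENNReal.inv_ne_zero.mpr ha.lintegral_ne_top,
    ENNReal.inv_ne_top.mpr (mul_ne_zero hδ ha.lintegral_ne_zero),
    fun y => ⟨inv_lintegral_le_sinkhornStep hk1 y, sinkhornStep_le ha.1 hkδ y⟩⟩

lemma sinkhornStep_mul_lintegral (hk : Measurable (Function.uncurry k)) (hδ : δ ≠ 0)
    (hkδ : ∀ x y, δ ≤ k x y) (hk1 : ∀ x y, k x y ≤ 1) (ha : IsPinched a) (y : Y) :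
    sinkhornStep μ k a y * ∫⁻ x, k x y * a x ∂μ = 1 := by
  have h := IsPinched.sinkhornStep (μ := μ) hk hδ hkδ hk1 ha
  exact ENNReal.inv_mul_cancel (fun h0 => h.ne_top y (by simp [_root_.sinkhornStep, h0]))
    (fun h0 => h.ne_zero y (by simp [_root_.sinkhornStep, h0]))

lemma lintegral_mul_inv_sinkhornStep_sinkhornStep (hk : Measurable (Function.uncurry k))
    (hδ : δ ≠ 0) (hkδ : ∀ x y, δ ≤ k x y) (hk1 : ∀ x y, k x y ≤ 1) (ha : IsPinched a) :
    ∫⁻ x, a x * (sinkhornStep ν (fun y x => k x y) (sinkhornStep μ k a) x)⁻¹ ∂μ = 1 := by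
  have hb := measurable_sinkhornStep (μ := μ) hk ha.1
  have hb' : Measurable fun p : X × Y => sinkhornStep μ k a p.2 := hb.comp measurable_snd
  have ha' : Measurable fun p : X × Y => a p.1 := ha.1.comp measurable_fst
  have hk' : Measurable fun p : X × Y => k p.1 p.2 := hk
  calc ∫⁻ x, a x * (sinkhornStep ν (fun y x => k x y) (sinkhornStep μ k a) x)⁻¹ ∂μ
      = ∫⁻ x, ∫⁻ y, a x * (k x y * sinkhornStep μ k a y) ∂ν ∂μ := by
        refine lintegral_congr fun x => ?_
        have hm : Measurable fun y => k x y * sinkhornStep μ k a y :=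
          (hk.comp measurable_prodMk_left).mul hb
        rw [lintegral_const_mul _ hm, sinkhornStep, inv_inv]
    _ = ∫⁻ y, ∫⁻ x, a x * (k x y * sinkhornStep μ k a y) ∂μ ∂ν :=
        lintegral_lintegral_swap (ha'.mul (hk'.mul hb')).aemeasurable
    _ = ∫⁻ _, 1 ∂ν := by
        refine lintegral_congr fun y => ?_
        have hm : Measurable fun x => k x y * a x := (hk.comp measurable_prodMk_right).mul ha.1
        rw [← sinkhornStep_mul_lintegral (μ := μ) hk hδ hkδ hk1 ha y, ← lintegral_const_mul _ hm]
        exact lintegral_congr fun x => by ring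
    _ = 1 := by simp

/-- The Sinkhorn iterates on `X`, started at the constant `1`. -/
def sinkhornIter (μ : Measure X) (ν : Measure Y) (k : X → Y → ℝ≥0∞) : ℕ → X → ℝ≥0∞
  | 0 => fun _ => 1
  | n + 1 => sinkhornStep ν (fun y x => k x y) (sinkhornStep μ k (sinkhornIter μ ν k n))

lemma isPinched_one : IsPinched (fun _ : X => (1 : ℝ≥0∞)) :=
  ⟨measurable_const, 1, 1, one_ne_zero, ENNReal.one_ne_top, fun _ => ⟨le_rfl, le_rfl⟩⟩

lemma measurable_uncurry_swap (hk : Measurable (Function.uncurry k)) :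
    Measurable (Function.uncurry fun y x => k x y) :=
  hk.comp measurable_swap

lemma isPinched_sinkhornIter (hk : Measurable (Function.uncurry k)) (hδ : δ ≠ 0)
    (hkδ : ∀ x y, δ ≤ k x y) (hk1 : ∀ x y, k x y ≤ 1) (n : ℕ) :
    IsPinched (sinkhornIter μ ν k n) := by
  induction n with
  | zero => exact isPinched_one
  | succ n ih =>
    exact IsPinched.sinkhornStep (measurable_uncurry_swap hk) hδ (fun y x => hkδ x y)
      (fun y x => hk1 x y) (IsPinched.sinkhornStep hk hδ hkδ hk1 ih)

lemma integral_log_sinkhornIter_nonneg (hk : Measurable (Function.uncurry k)) (hδ : δ ≠ 0)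
    (hkδ : ∀ x y, δ ≤ k x y) (hk1 : ∀ x y, k x y ≤ 1) (n : ℕ) :
    0 ≤ ∫ x, Real.log (sinkhornIter μ ν k n x).toReal ∂μ := by
  induction n with
  | zero => simp [sinkhornIter]
  | succ n ih =>
    exact ih.trans (IsPinched.integral_log_le (isPinched_sinkhornIter hk hδ hkδ hk1 n)
      (isPinched_sinkhornIter hk hδ hkδ hk1 (n + 1))
      (lintegral_mul_inv_sinkhornStep_sinkhornStep hk hδ hkδ hk1
        (isPinched_sinkhornIter hk hδ hkδ hk1 n)))

lemma integral_log_sinkhornStep_sinkhornIter_nonneg (hk : Measurable (Function.uncurry k))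
    (hδ : δ ≠ 0) (hkδ : ∀ x y, δ ≤ k x y) (hk1 : ∀ x y, k x y ≤ 1) (n : ℕ) :
    0 ≤ ∫ y, Real.log (sinkhornStep μ k (sinkhornIter μ ν k n) y).toReal ∂ν := by
  have hp n := IsPinched.sinkhornStep (μ := μ) hk hδ hkδ hk1
    (isPinched_sinkhornIter (μ := μ) (ν := ν) hk hδ hkδ hk1 n)
  induction n with
  | zero =>
    refine integral_nonneg fun y => Real.log_nonneg ?_
    rw [← ENNReal.toReal_one]
    refine ENNReal.toReal_mono ((hp 0).ne_top y) ?_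
    simpa [sinkhornIter] using inv_lintegral_le_sinkhornStep (μ := μ) (a := fun _ => 1) hk1 y
  | succ n ih =>
    exact ih.trans (IsPinched.integral_log_le (hp n) (hp (n + 1))
      (lintegral_mul_inv_sinkhornStep_sinkhornStep (measurable_uncurry_swap hk) hδ
        (fun y x => hkδ x y) (fun y x => hk1 x y) (hp n)))

lemma le_lintegral_sinkhornIter (hk : Measurable (Function.uncurry k)) (hδ : δ ≠ 0)
    (hkδ : ∀ x y, δ ≤ k x y) (hk1 : ∀ x y, k x y ≤ 1) (n : ℕ) :
    δ ≤ ∫⁻ x, sinkhornIter μ ν k n x ∂μ := by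
  set m := ∫⁻ x, sinkhornIter μ ν k n x ∂μ with hm
  have hp := isPinched_sinkhornIter (μ := μ) (ν := ν) hk hδ hkδ hk1 n
  have hb : m⁻¹ ≤ ∫⁻ y, sinkhornStep μ k (sinkhornIter μ ν k n) y ∂ν := by
    simpa using lintegral_mono (μ := ν) (inv_lintegral_le_sinkhornStep (μ := μ)
      (a := sinkhornIter μ ν k n) hk1)
  have h := (isPinched_sinkhornIter (μ := μ) (ν := ν) hk hδ hkδ hk1
    (n + 1)).one_le_of_integral_log_nonneg
    (integral_log_sinkhornIter_nonneg hk hδ hkδ hk1 (n + 1)) (C := (δ * m⁻¹)⁻¹) fun x =>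
      (sinkhornStep_le (measurable_sinkhornStep hk hp.1) (fun y x => hkδ x y) x).trans
        (ENNReal.inv_le_inv.mpr (mul_le_mul_right hb _))
  rw [ENNReal.one_le_inv, ← div_eq_mul_inv] at h
  simpa using (ENNReal.div_le_iff hp.lintegral_ne_zero hp.lintegral_ne_top).mp h

lemma lintegral_sinkhornIter_le (hk : Measurable (Function.uncurry k)) (hδ : δ ≠ 0)
    (hkδ : ∀ x y, δ ≤ k x y) (hk1 : ∀ x y, k x y ≤ 1) (n : ℕ) :
    ∫⁻ x, sinkhornIter μ ν k n x ∂μ ≤ δ⁻¹ := by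
  have hp := isPinched_sinkhornIter (μ := μ) (ν := ν) hk hδ hkδ hk1 n
  have h := (hp.sinkhornStep (μ := μ) hk hδ hkδ hk1).one_le_of_integral_log_nonneg
    (integral_log_sinkhornStep_sinkhornIter_nonneg (ν := ν) hk hδ hkδ hk1 n)
    (sinkhornStep_le hp.1 hkδ)
  rw [ENNReal.one_le_inv, mul_comm] at h
  exact ENNReal.le_inv_iff_mul_le.mpr h

lemma sinkhornStep_sinkhornIter_le (hk : Measurable (Function.uncurry k)) (hδ : δ ≠ 0)
    (hkδ : ∀ x y, δ ≤ k x y) (hk1 : ∀ x y, k x y ≤ 1) (n : ℕ) (y : Y) :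
    sinkhornStep μ k (sinkhornIter μ ν k n) y ≤ (δ * δ)⁻¹ :=
  (sinkhornStep_le (isPinched_sinkhornIter hk hδ hkδ hk1 n).1 hkδ y).trans
    (ENNReal.inv_le_inv.mpr (mul_le_mul_right (le_lintegral_sinkhornIter hk hδ hkδ hk1 n) _))

lemma le_sinkhornStep_sinkhornIter (hk : Measurable (Function.uncurry k)) (hδ : δ ≠ 0)
    (hkδ : ∀ x y, δ ≤ k x y) (hk1 : ∀ x y, k x y ≤ 1) (n : ℕ) (y : Y) :
    δ ≤ sinkhornStep μ k (sinkhornIter μ ν k n) y :=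
  (ENNReal.le_inv_iff_le_inv.mp (lintegral_sinkhornIter_le hk hδ hkδ hk1 n)).trans
    (inv_lintegral_le_sinkhornStep hk1 y)

lemma sinkhornIter_succ_mem_Icc (hk : Measurable (Function.uncurry k)) (hδ : δ ≠ 0)
    (hkδ : ∀ x y, δ ≤ k x y) (hk1 : ∀ x y, k x y ≤ 1) (n : ℕ) (x : X) :
    δ * δ ≤ sinkhornIter μ ν k (n + 1) x ∧ sinkhornIter μ ν k (n + 1) x ≤ (δ * δ)⁻¹ := by
  have hp := (isPinched_sinkhornIter (μ := μ) (ν := ν) hk hδ hkδ hk1 n).sinkhornStep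
    (μ := μ) hk hδ hkδ hk1
  constructor
  · refine le_trans ?_ (inv_lintegral_le_sinkhornStep (fun y x => hk1 x y) x)
    refine ENNReal.le_inv_iff_le_inv.mp ?_
    simpa using lintegral_mono (μ := ν) (sinkhornStep_sinkhornIter_le hk hδ hkδ hk1 n)
  · refine (sinkhornStep_le hp.1 (fun y x => hkδ x y) x).trans
      (ENNReal.inv_le_inv.mpr (mul_le_mul_right ?_ _))
    simpa using lintegral_mono (μ := ν) (le_sinkhornStep_sinkhornIter hk hδ hkδ hk1 n)

/-- Existence of Schrödinger scalings for a kernel pinched between positive constants. -/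
lemma exists_schrodinger_scalings (hk : Measurable (Function.uncurry k)) (hδ : δ ≠ 0)
    (hkδ : ∀ x y, δ ≤ k x y) (hk1 : ∀ x y, k x y ≤ 1) :
    ∃ (a : X → ℝ≥0∞) (b : Y → ℝ≥0∞), IsPinched a ∧ IsPinched b ∧
      (∀ᵐ x ∂μ, a x * ∫⁻ y, k x y * b y ∂ν = 1) ∧ ∀ y, b y * ∫⁻ x, k x y * a x ∂μ = 1 := by
  set u : ℕ → X → ℝ≥0∞ := sinkhornIter μ ν k with hu
  have hup n : IsPinched (u n) := isPinched_sinkhornIter hk hδ hkδ hk1 n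
  have hkx x : Measurable (k x) := hk.comp measurable_prodMk_left
  have hky y : Measurable fun x => k x y := hk.comp measurable_prodMk_right
  have hsm n := measurable_sinkhornStep (μ := μ) hk (hup n).1
  set A : X → ℝ≥0∞ := fun x => liminf (fun n => u n x) atTop with hA
  have hAm : Measurable A := Measurable.liminf fun n => (hup n).1
  have hA' x : A x = liminf (fun n => u (n + 1) x) atTop :=
    (liminf_nat_add (fun n => u n x) 1).symm
  have hAp : IsPinched A := by
    refine ⟨hAm, δ * δ, (δ * δ)⁻¹, mul_ne_zero hδ hδ, ENNReal.inv_ne_top.mpr (mul_ne_zero hδ hδ),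
      fun x => ⟨?_, ?_⟩⟩
    · rw [hA']
      exact le_liminf_of_le (by isBoundedDefault)
        (Eventually.of_forall fun n => (sinkhornIter_succ_mem_Icc hk hδ hkδ hk1 n x).1)
    · rw [hA']
      exact liminf_le_of_le (by isBoundedDefault) fun b hb => by
        obtain ⟨n, hn⟩ := hb.exists
        exact hn.trans (sinkhornIter_succ_mem_Icc hk hδ hkδ hk1 n x).2
  have hBp := hAp.sinkhornStep (μ := μ) hk hδ hkδ hk1
  set B := sinkhornStep μ k A with hB
  have hlimB y : limsup (fun n => sinkhornStep μ k (u n) y) atTop ≤ B y := by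
    simp only [hB, sinkhornStep]
    rw [← ENNReal.inv_liminf, ENNReal.inv_le_inv]
    refine le_trans (lintegral_mono fun x => ?_)
      (lintegral_liminf_le fun n => (hky y).mul (hup n).1)
    exact (ENNReal.liminf_const_mul_of_ne_top
      (ne_top_of_le_ne_top ENNReal.one_ne_top (hk1 x y))).ge
  have hSA x : sinkhornStep ν (fun y x => k x y) B x ≤ A x := by
    rw [hA']
    simp only [hu, sinkhornIter]
    simp only [sinkhornStep.eq_1 ν]
    rw [← ENNReal.inv_limsup, ENNReal.inv_le_inv]
    refine (limsup_lintegral_le (fun _ => (δ * δ)⁻¹) (fun n => (hkx x).mul (hsm n))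
      (fun n => ae_of_all _ fun y => (mul_le_of_le_one_left' (hk1 x y)).trans
        (sinkhornStep_sinkhornIter_le hk hδ hkδ hk1 n y))
      (by simp [hδ])).trans (lintegral_mono fun y => ?_)
    exact (ENNReal.limsup_const_mul_of_ne_top
      (ne_top_of_le_ne_top ENNReal.one_ne_top (hk1 x y))).trans_le (mul_le_mul_right (hlimB y) _)
  have hSp := hBp.sinkhornStep (μ := ν) (measurable_uncurry_swap hk) hδ (fun y x => hkδ x y)
    (fun y x => hk1 x y)
  refine ⟨A, B, hAp, hBp, ?_, sinkhornStep_mul_lintegral hk hδ hkδ hk1 hAp⟩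
  have hmass := lintegral_mul_inv_sinkhornStep_sinkhornStep (ν := ν) (μ := μ) hk hδ hkδ hk1 hAp
  have hae := ae_eq_of_ae_le_of_lintegral_le (μ := μ) (f := fun _ => 1)
    (g := fun x => A x * (sinkhornStep ν (fun y x => k x y) B x)⁻¹)
    (ae_of_all _ fun x => by
      rw [← ENNReal.mul_inv_cancel (hSp.ne_zero x) (hSp.ne_top x)]
      exact mul_le_mul_left (hSA x) _) (by simp) (hAm.mul hSp.1.inv).aemeasurable
    (by simpa using hmass.le)
  filter_upwards [hae] with x hx
  simpa [sinkhornStep] using hx.symm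

end Sinkhorn

section Gibbs

open InformationTheory

lemma phiKL_nonneg {s : ℝ} (hs : 0 ≤ s) : 0 ≤ phiKL s := by
  have := klFun_nonneg hs
  rw [klFun_apply] at this
  unfold phiKL
  linarith

lemma measurable_phiKL : Measurable phiKL := by unfold phiKL; fun_prop

lemma phiKL_sub_phiKL_exp (s g : ℝ) :
    phiKL s - phiKL (Real.exp g) - g * (s - Real.exp g)
      = Real.exp g * klFun (s * Real.exp (-g)) := by
  have he : Real.exp g * Real.exp (-g) = 1 := by rw [← Real.exp_add]; simp
  rcases eq_or_ne s 0 with rfl | hs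
  · simp [phiKL, klFun]; ring
  · rw [phiKL, phiKL, klFun_apply, Real.log_mul hs (Real.exp_pos _).ne', Real.log_exp,
      Real.log_exp]
    linear_combination (s - s * Real.log s + s * g) * he

variable {Z : Type*} [MeasurableSpace Z] {P ρ : Measure Z}

lemma absolutelyContinuous_of_KL_ne_top (h : KL ρ P ≠ ⊤) : ρ ≪ P := by
  by_contra hn
  exact h (if_neg hn)

lemma KL_of_absolutelyContinuous (h : ρ ≪ P) :
    KL ρ P = ∫⁻ z, ENNReal.ofReal (phiKL ((ρ.rnDeriv P) z).toReal) ∂P :=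
  if_pos h

lemma measurable_phiKL_rnDeriv : Measurable fun z => phiKL ((ρ.rnDeriv P) z).toReal :=
  measurable_phiKL.comp (Measure.measurable_rnDeriv ρ P).ennreal_toReal

lemma toReal_KL (h : ρ ≪ P) : (KL ρ P).toReal = ∫ z, phiKL ((ρ.rnDeriv P) z).toReal ∂P := by
  rw [KL_of_absolutelyContinuous h, integral_eq_lintegral_of_nonneg_ae
    (ae_of_all _ fun z => phiKL_nonneg ENNReal.toReal_nonneg)
    measurable_phiKL_rnDeriv.aestronglyMeasurable]

lemma KL_ne_top_iff_integrable (h : ρ ≪ P) :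
    KL ρ P ≠ ⊤ ↔ Integrable (fun z => phiKL ((ρ.rnDeriv P) z).toReal) P := by
  rw [KL_of_absolutelyContinuous h]
  exact lintegral_ofReal_ne_top_iff_integrable measurable_phiKL_rnDeriv.aestronglyMeasurable
    (ae_of_all _ fun z => phiKL_nonneg ENNReal.toReal_nonneg)

variable [IsProbabilityMeasure P] {g : Z → ℝ} {C : ℝ}

lemma rnDeriv_withDensity_exp (hg : Measurable g) :
    (fun z => (((P.withDensity fun z => ENNReal.ofReal (Real.exp (g z))).rnDeriv P) z).toReal)
      =ᵐ[P] fun z => Real.exp (g z) := by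
  filter_upwards [Measure.rnDeriv_withDensity P
    (f := fun z => ENNReal.ofReal (Real.exp (g z))) (by fun_prop)] with z hz
  rw [hz, ENNReal.toReal_ofReal (Real.exp_pos _).le]

lemma KL_withDensity_exp_ne_top (hg : Measurable g) (hC : ∀ z, |g z| ≤ C) :
    KL (P.withDensity fun z => ENNReal.ofReal (Real.exp (g z))) P ≠ ⊤ := by
  rw [KL_ne_top_iff_integrable (withDensity_absolutelyContinuous _ _)]
  have hi : Integrable (fun z => phiKL (Real.exp (g z))) P := by
    refine Integrable.of_bound (measurable_phiKL.comp hg.exp).aestronglyMeasurable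
      (Real.exp C * C + Real.exp C + 1) (ae_of_all _ fun z => ?_)
    have h1 : Real.exp (g z) ≤ Real.exp C := Real.exp_le_exp.mpr ((abs_le.mp (hC z)).2)
    have h0 := Real.exp_pos (g z)
    rw [Real.norm_eq_abs, abs_of_nonneg (phiKL_nonneg h0.le), phiKL, Real.log_exp]
    have : Real.exp (g z) * g z ≤ Real.exp C * C :=
      (mul_le_mul_of_nonneg_left (abs_le.mp (hC z)).2 h0.le).trans
        (mul_le_mul_of_nonneg_right h1 ((abs_nonneg _).trans (hC z)))
    linarith
  refine hi.congr ?_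
  filter_upwards [rnDeriv_withDensity_exp (P := P) hg] with z hz
  rw [hz]

/-- Gibbs variational principle: among probability measures, `KL(·|P) - ⟨g,·⟩` has the unique
minimizer `exp(g)·P` whenever the latter is a probability measure. -/
lemma eq_withDensity_exp_of_KL_le [IsProbabilityMeasure ρ] (hg : Measurable g)
    (hC : ∀ z, |g z| ≤ C)
    [IsProbabilityMeasure (P.withDensity fun z => ENNReal.ofReal (Real.exp (g z)))]
    (hρ : KL ρ P ≠ ⊤)
    (hle : (KL ρ P).toReal - ∫ z, g z ∂ρ ≤
      (KL (P.withDensity fun z => ENNReal.ofReal (Real.exp (g z))) P).toReal -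
        ∫ z, g z ∂(P.withDensity fun z => ENNReal.ofReal (Real.exp (g z)))) :
    ρ = P.withDensity fun z => ENNReal.ofReal (Real.exp (g z)) := by
  have hQtop := KL_withDensity_exp_ne_top (P := P) hg hC
  have hQder := rnDeriv_withDensity_exp (P := P) hg
  set Q := P.withDensity fun z => ENNReal.ofReal (Real.exp (g z)) with hQ
  have hac : ρ ≪ P := absolutelyContinuous_of_KL_ne_top hρ
  have hacQ : Q ≪ P := withDensity_absolutelyContinuous _ _
  have hgi (σ : Measure Z) [IsProbabilityMeasure σ] : Integrable g σ :=
    Integrable.of_bound hg.aestronglyMeasurable C (ae_of_all _ hC)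
  set f : Z → ℝ := fun z => ((ρ.rnDeriv P) z).toReal with hf
  set q : Z → ℝ := fun z => ((Q.rnDeriv P) z).toReal with hq
  have hfφ : Integrable (fun z => phiKL (f z)) P := (KL_ne_top_iff_integrable hac).mp hρ
  have hqφ : Integrable (fun z => phiKL (q z)) P := (KL_ne_top_iff_integrable hacQ).mp hQtop
  have hfg : Integrable (fun z => f z * g z) P :=
    (integrable_toReal_rnDeriv_mul_iff hac).mpr (hgi ρ)
  have hqg : Integrable (fun z => q z * g z) P :=
    (integrable_toReal_rnDeriv_mul_iff hacQ).mpr (hgi Q)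
  rw [toReal_KL hac, toReal_KL hacQ, ← integral_toReal_rnDeriv_mul hac,
    ← integral_toReal_rnDeriv_mul hacQ, ← integral_sub hfφ hfg, ← integral_sub hqφ hqg] at hle
  have hgap : (fun z => (phiKL (f z) - f z * g z) - (phiKL (q z) - q z * g z)) =ᵐ[P]
      fun z => Real.exp (g z) * klFun (f z * Real.exp (-g z)) := by
    filter_upwards [hQder] with z hz
    rw [← phiKL_sub_phiKL_exp, show q z = Real.exp (g z) from hz]
    ring
  have hnn : ∀ z, 0 ≤ Real.exp (g z) * klFun (f z * Real.exp (-g z)) := fun z =>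
    mul_nonneg (Real.exp_pos _).le
      (klFun_nonneg (mul_nonneg ENNReal.toReal_nonneg (Real.exp_pos _).le))
  have hint := ((hfφ.sub hfg).sub (hqφ.sub hqg)).congr hgap
  have hzero : ∫ z, Real.exp (g z) * klFun (f z * Real.exp (-g z)) ∂P = 0 := by
    refine le_antisymm ?_ (integral_nonneg hnn)
    rw [← integral_congr_ae hgap]
    exact (integral_sub (hfφ.sub hfg) (hqφ.sub hqg)).trans_le (sub_nonpos.mpr hle)
  rw [integral_eq_zero_iff_of_nonneg hnn hint] at hzero
  rw [← Measure.withDensity_rnDeriv_eq ρ P hac, hQ]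
  refine withDensity_congr_ae ?_
  filter_upwards [hzero, Measure.rnDeriv_lt_top ρ P] with z hz hlt
  have h1 : f z * Real.exp (-g z) = 1 :=
    (klFun_eq_zero_iff (mul_nonneg ENNReal.toReal_nonneg (Real.exp_pos _).le)).mp
      ((mul_eq_zero.mp hz).resolve_left (Real.exp_pos _).ne')
  have h2 : f z = Real.exp (g z) := by
    rw [Real.exp_neg, mul_inv_eq_one₀ (Real.exp_pos _).ne'] at h1
    exact h1
  rw [← h2, hf, ENNReal.ofReal_toReal hlt.ne]

end Gibbs

lemma EOT_eq_coe {X Y : Type*} [MeasurableSpace X] [MeasurableSpace Y] {c : X × Y → ℝ} {ε : ℝ}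
    {μ : Measure X} {ν : Measure Y} {π : Measure (X × Y)} (h : KL π (μ.prod ν) ≠ ⊤) :
    EOT c ε μ ν π = ((∫ p, c p ∂π + ε * (KL π (μ.prod ν)).toReal : ℝ) : EReal) := by
  rw [EOT, EReal.coe_add, EReal.coe_mul]
  congr 2
  conv_lhs => rw [← ENNReal.ofReal_toReal h]
  rw [EReal.coe_ennreal_ofReal, max_eq_left ENNReal.toReal_nonneg]

lemma EOT_eq_top {X Y : Type*} [MeasurableSpace X] [MeasurableSpace Y] {c : X × Y → ℝ} {ε : ℝ}
    (hε : 0 < ε) {μ : Measure X} {ν : Measure Y} {π : Measure (X × Y)}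
    (h : KL π (μ.prod ν) = ⊤) : EOT c ε μ ν π = ⊤ := by
  rw [EOT, h, EReal.coe_ennreal_top, EReal.coe_mul_top_of_pos hε, EReal.coe_add_top]

lemma IsCoupling.isProbabilityMeasure {X Y : Type*} [MeasurableSpace X] [MeasurableSpace Y]
    {μ : Measure X} {ν : Measure Y} [IsProbabilityMeasure μ] {π : Measure (X × Y)}
    (h : IsCoupling μ ν π) : IsProbabilityMeasure π :=
  ⟨by rw [← measure_univ (μ := μ), ← h.1, Measure.map_apply measurable_fst .univ,
    Set.preimage_univ]⟩

lemma isCoupling_withDensity {X Y : Type*} [MeasurableSpace X] [MeasurableSpace Y]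
    {μ : Measure X} {ν : Measure Y} [SFinite μ] [SFinite ν] {h : X × Y → ℝ≥0∞}
    (hm : Measurable h) (h1 : ∀ᵐ x ∂μ, ∫⁻ y, h (x, y) ∂ν = 1)
    (h2 : ∀ᵐ y ∂ν, ∫⁻ x, h (x, y) ∂μ = 1) :
    IsCoupling μ ν ((μ.prod ν).withDensity h) := by
  constructor
  · ext s hs
    rw [Measure.map_apply measurable_fst hs, withDensity_apply _ (measurable_fst hs),
      ← Set.prod_univ, setLIntegral_prod _ hm.aemeasurable]
    simp only [Measure.restrict_univ]
    rw [lintegral_congr_ae (ae_restrict_of_ae h1)]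
    simp
  · ext s hs
    rw [Measure.map_apply measurable_snd hs, withDensity_apply _ (measurable_snd hs),
      ← Set.univ_prod, ← Measure.prod_restrict, lintegral_prod_symm' _ hm]
    simp only [Measure.restrict_univ]
    rw [lintegral_congr_ae (ae_restrict_of_ae h2)]
    simp

/-- A bounded additively separated minus cost function integrates against a coupling through the
marginals. -/
lemma IsCoupling.integral_add_sub {X Y : Type*} [MeasurableSpace X] [MeasurableSpace Y]
    {μ : Measure X} {ν : Measure Y} {π : Measure (X × Y)} (h : IsCoupling μ ν π)
    {f : X → ℝ} {g : Y → ℝ} {c : X × Y → ℝ} (hf : Integrable f μ) (hg : Integrable g ν)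
    (hc : Integrable c π) :
    ∫ p, (f p.1 + g p.2 - c p) ∂π = ∫ x, f x ∂μ + ∫ y, g y ∂ν - ∫ p, c p ∂π := by
  obtain ⟨h1, h2⟩ := h
  have hf' : Integrable (fun p : X × Y => f p.1) π :=
    (h1.symm ▸ hf : Integrable f (π.map Prod.fst)).comp_measurable measurable_fst
  have hg' : Integrable (fun p : X × Y => g p.2) π :=
    (h2.symm ▸ hg : Integrable g (π.map Prod.snd)).comp_measurable measurable_snd
  have e1 : ∫ p, f p.1 ∂π = ∫ x, f x ∂μ := by
    rw [← h1, integral_map measurable_fst.aemeasurable (by rw [h1]; exact hf.1)]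
  have e2 : ∫ p, g p.2 ∂π = ∫ y, g y ∂ν := by
    rw [← h2, integral_map measurable_snd.aemeasurable (by rw [h2]; exact hg.1)]
  rw [← e1, ← e2, ← integral_add hf' hg']
  exact integral_sub (hf'.add hg') hc

/-- the minimizer of the entropic OT problem has the form
`π* = exp((α*(x)+β*(y)−c(x,y))/ε)·(μ⊗ν)` for measurable potentials `α*`, `β*`. -/
theorem entropic_OT_minimizer_has_potentials
    {X Y : Type*} [MetricSpace X] [CompactSpace X] [MeasurableSpace X] [BorelSpace X]
    [MetricSpace Y] [CompactSpace Y] [MeasurableSpace Y] [BorelSpace Y]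
    (μ : Measure X) (ν : Measure Y) [IsProbabilityMeasure μ] [IsProbabilityMeasure ν]
    (c : X × Y → ℝ) (hc_lsc : LowerSemicontinuous c) (hc_nonneg : ∀ p, 0 ≤ c p)
    (M : ℝ) (hc_bdd : ∀ p, c p ≤ M) (ε : ℝ) (hε : 0 < ε)
    (πstar : Measure (X × Y)) (hπstar : IsCoupling μ ν πstar)
    (hmin : ∀ π : Measure (X × Y), IsCoupling μ ν π →
      EOT c ε μ ν πstar ≤ EOT c ε μ ν π) :
    ∃ (αstar : X → ℝ) (βstar : Y → ℝ), Measurable αstar ∧ Measurable βstar ∧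
      πstar = (μ.prod ν).withDensity
        (fun p => ENNReal.ofReal (Real.exp ((αstar p.1 + βstar p.2 - c p) / ε))) := by
  have hcm : Measurable c := hc_lsc.measurable
  set k : X → Y → ℝ≥0∞ := fun x y => ENNReal.ofReal (Real.exp (-c (x, y) / ε)) with hk_def
  have hk : Measurable (Function.uncurry k) := by
    change Measurable fun p : X × Y => ENNReal.ofReal (Real.exp (-c (p.1, p.2) / ε))
    fun_prop
  have hkδ x y : ENNReal.ofReal (Real.exp (-M / ε)) ≤ k x y :=
    ENNReal.ofReal_le_ofReal (Real.exp_le_exp.mpr (by gcongr; exact hc_bdd _))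
  have hk1 x y : k x y ≤ 1 := by
    refine ENNReal.ofReal_le_one.mpr (Real.exp_le_one_iff.mpr ?_)
    exact div_nonpos_of_nonpos_of_nonneg (neg_nonpos.mpr (hc_nonneg _)) hε.le
  obtain ⟨a, b, ha, hb, hab1, hab2⟩ := exists_schrodinger_scalings (μ := μ) (ν := ν) hk
    (ENNReal.ofReal_pos.mpr (Real.exp_pos _)).ne' hkδ hk1
  set α : X → ℝ := fun x => ε * Real.log (a x).toReal with hα
  set β : Y → ℝ := fun y => ε * Real.log (b y).toReal with hβ
  have hαm : Measurable α := ha.measurable_log.const_mul ε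
  have hβm : Measurable β := hb.measurable_log.const_mul ε
  refine ⟨α, β, hαm, hβm, ?_⟩
  set g : X × Y → ℝ := fun p => (α p.1 + β p.2 - c p) / ε with hg_def
  have hg : Measurable g := by fun_prop
  have hdens x y : ENNReal.ofReal (Real.exp (g (x, y))) = k x y * a x * b y := by
    have h1 := ENNReal.toReal_pos (ha.ne_zero x) (ha.ne_top x)
    have h2 := ENNReal.toReal_pos (hb.ne_zero y) (hb.ne_top y)
    have : g (x, y) = -c (x, y) / ε + Real.log (a x).toReal + Real.log (b y).toReal := by
      simp only [hg_def, hα, hβ]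
      field_simp
      ring
    rw [this, Real.exp_add, Real.exp_add, Real.exp_log h1, Real.exp_log h2,
      ENNReal.ofReal_mul (by positivity), ENNReal.ofReal_mul (by positivity),
      ENNReal.ofReal_toReal (ha.ne_top x), ENNReal.ofReal_toReal (hb.ne_top y)]
  have hQ : IsCoupling μ ν
      ((μ.prod ν).withDensity fun p => ENNReal.ofReal (Real.exp (g p))) := by
    refine isCoupling_withDensity (by fun_prop) ?_ (ae_of_all _ fun y => ?_)
    · filter_upwards [hab1] with x hx
      have hm : Measurable fun y => k x y * b y := (hk.comp measurable_prodMk_left).mul hb.1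
      rw [← hx, ← lintegral_const_mul _ hm]
      exact lintegral_congr fun y => by rw [hdens]; ring
    · have hm : Measurable fun x => k x y * a x := (hk.comp measurable_prodMk_right).mul ha.1
      rw [← hab2 y, ← lintegral_const_mul _ hm]
      exact lintegral_congr fun x => by rw [hdens]; ring
  obtain ⟨Ca, hCa⟩ := ha.exists_abs_log_le
  obtain ⟨Cb, hCb⟩ := hb.exists_abs_log_le
  have hC p : |g p| ≤ Ca + Cb + M / ε := by
    have hg' : g p = Real.log (a p.1).toReal + Real.log (b p.2).toReal - c p / ε := by
      simp only [hg_def, hα, hβ]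
      field_simp
    have hcp : |c p / ε| ≤ M / ε := by
      rw [abs_of_nonneg (div_nonneg (hc_nonneg p) hε.le)]
      gcongr
      exact hc_bdd p
    rw [hg']
    exact (abs_sub _ _).trans (add_le_add ((abs_add_le _ _).trans (add_le_add (hCa _) (hCb _))) hcp)
  have hQtop := KL_withDensity_exp_ne_top (P := μ.prod ν) hg hC
  have := hQ.isProbabilityMeasure
  have := hπstar.isProbabilityMeasure
  have hle := hmin _ hQ
  have htop : KL πstar (μ.prod ν) ≠ ⊤ := fun h => by
    rw [EOT_eq_top hε h, EOT_eq_coe hQtop] at hle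
    exact EReal.coe_ne_top _ (top_le_iff.mp hle)
  rw [EOT_eq_coe htop, EOT_eq_coe hQtop, EReal.coe_le_coe_iff] at hle
  have hgint (σ : Measure (X × Y)) [IsProbabilityMeasure σ] (hσ : IsCoupling μ ν σ) :
      ∫ p, g p ∂σ = (∫ x, α x ∂μ + ∫ y, β y ∂ν - ∫ p, c p ∂σ) / ε := by
    have hci : Integrable c σ := Integrable.of_bound hcm.aestronglyMeasurable M
      (ae_of_all _ fun p => by
        rw [Real.norm_eq_abs, abs_of_nonneg (hc_nonneg p)]
        exact hc_bdd p)
    rw [← hσ.integral_add_sub (ha.integrable_log.const_mul ε) (hb.integrable_log.const_mul ε) hci,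
      ← integral_div]
  refine eq_withDensity_exp_of_KL_le hg hC htop ?_
  rw [hgint _ hπstar, hgint _ hQ]
  refine le_of_mul_le_mul_left ?_ hε
  rw [mul_sub, mul_sub, mul_div_cancel₀ _ hε.ne', mul_div_cancel₀ _ hε.ne']
  linarith
end
end

section
/- Let w be a mass-preserving flow and π̂ := Σ_{j∈I} Σ_{i∈𝒩(j)} w_{ij}·π̂_{ij} the induced plan, where for i≠j the π̂_{ij} are gluing edge candidates built from couplings γ_{ij} ∈ Π(μ_i/m_i, μ_j/m_j), and π̂_{ii} = π_i/m_i. Then the entropic objective does not increase: KL(π̂ | μ⊗ν) ≤ KL(π | μ⊗ν). -/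
open MeasureTheory Filter Topology
open scoped ENNReal

noncomputable section

/-- The family of gluing edge candidates: `π̂_{ii} = π_i/m_i` on the diagonal, and for `i ≠ j`
the gluing candidate `π̂_{ij}(A×B) = (1/m_i) ∫_{X_i} (γ_{ij})_x(A)·(π_i)_x(B) dμ_i(x)`,
formalized via `Measure.bind` over the disintegration kernels `γk i j` and `πk i`. -/
def gluingPihat {X Y : Type*} [MeasurableSpace X] [MeasurableSpace Y]
    {I : Type*} [DecidableEq I]
    (μ : Measure X) (π : Measure (X × Y)) (Xpart : I → Set X)
    (γk : I → I → X → Measure X) (πk : I → X → Measure Y) (i j : I) : Measure (X × Y) :=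
  if i = j then (μ (Xpart i))⁻¹ • π.restrict (Xpart i ×ˢ Set.univ)
  else (μ (Xpart i))⁻¹ • (μ.restrict (Xpart i)).bind (fun x => (γk i j x).prod (πk i x))

open ProbabilityTheory InformationTheory in
lemma KL_eq_klDiv {Z : Type*} [MeasurableSpace Z] (ρ σ : Measure Z)
    [IsFiniteMeasure ρ] [IsFiniteMeasure σ] : KL ρ σ = klDiv ρ σ := by
  have hφ : phiKL = klFun := by
    funext s
    rw [phiKL, klFun]
    ring
  rw [klDiv_eq_lintegral_klFun, KL, hφ]

/-- Markov kernels prescribed on a.e. disjoint sets can be glued to a single one. -/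
lemma exists_isMarkovKernel_ae_eq_restrict {X Z I : Type*} [MeasurableSpace X]
    [MeasurableSpace Z] [Countable I] (μ : Measure X)
    (s : I → Set X) (hs : ∀ i, MeasurableSet (s i))
    (hdisj : ∀ i j, i ≠ j → μ (s i ∩ s j) = 0) (k : I → X → Measure Z)
    (hk : ∀ i, Measurable (k i)) (hkp : ∀ i x, IsProbabilityMeasure (k i x))
    (k₀ : ProbabilityTheory.Kernel X Z) [ProbabilityTheory.IsMarkovKernel k₀] :
    ∃ K : ProbabilityTheory.Kernel X Z, ProbabilityTheory.IsMarkovKernel K ∧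
      ∀ i, ∀ᵐ x ∂μ.restrict (s i), K x = k i x := by
  set U : I → Set X := fun i => s i \ ⋃ j : {j // j ≠ i}, s j with hU
  have hUm : ∀ i, MeasurableSet (U i) := fun i =>
    (hs i).diff (MeasurableSet.iUnion fun j => hs j)
  have hUd : ∀ i j x, x ∈ U i → x ∈ U j → i = j := by
    intro i j x hi hj
    by_contra hij
    exact hi.2 (Set.mem_iUnion.2 ⟨⟨j, Ne.symm hij⟩, hj.1⟩)
  let t : Option I → Set X := fun o => o.elim (⋃ i, U i)ᶜ U
  let g : Option I → X → Measure Z := fun o => o.elim k₀ k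
  obtain ⟨f, hf, hfg⟩ := exists_measurable_piecewise t
    (by rintro (_ | i); exacts [(MeasurableSet.iUnion hUm).compl, hUm i]) g
    (by rintro (_ | i); exacts [k₀.measurable, hk i])
    (by
      rintro (_ | i) (_ | j) hij x ⟨hx, hx'⟩
      · exact absurd rfl hij
      · exact absurd (Set.mem_iUnion.2 ⟨j, hx'⟩) hx
      · exact absurd (Set.mem_iUnion.2 ⟨i, hx⟩) hx'
      · exact absurd (congrArg some (hUd i j x hx hx')) hij)
  refine ⟨⟨f, hf⟩, ⟨fun x => ?_⟩, fun i => ?_⟩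
  · change IsProbabilityMeasure (f x)
    by_cases hx : x ∈ ⋃ i, U i
    · obtain ⟨i, hi⟩ := Set.mem_iUnion.1 hx
      rw [hfg (some i) hi]
      exact hkp i x
    · rw [hfg none hx]
      exact inferInstanceAs (IsProbabilityMeasure (k₀ x))
  · rw [ae_restrict_iff' (hs i)]
    have h : ∀ j : {j // j ≠ i}, ∀ᵐ x ∂μ, x ∉ s i ∩ s j := fun j =>
      measure_eq_zero_iff_ae_notMem.1 (hdisj i j j.2.symm)
    filter_upwards [ae_all_iff.2 h] with x hx hxi
    refine hfg (some i) ⟨hxi, fun hx' => ?_⟩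
    obtain ⟨j, hj⟩ := Set.mem_iUnion.1 hx'
    exact hx j ⟨hxi, hj⟩

open ProbabilityTheory in
lemma comp_eq_sum_smul_comp {X Z J : Type*} [MeasurableSpace X] [MeasurableSpace Z] [Fintype J]
    (μ : Measure X) (K : Kernel X Z) (c : J → ℝ≥0∞) (G : J → Kernel X Z)
    (h : ∀ᵐ x ∂μ, K x = ∑ j, c j • G j x) :
    μ.bind K = ∑ j, c j • μ.bind (G j) := by
  ext s hs
  rw [Measure.bind_apply hs K.aemeasurable, Measure.finsetSum_apply]
  simp only [Measure.smul_apply, smul_eq_mul, Measure.bind_apply hs (G _).aemeasurable]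
  have h' : ∀ᵐ x ∂μ, K x s = ∑ j, c j * G j x s := by
    filter_upwards [h] with x hx
    simp [hx, Measure.finsetSum_apply]
  rw [lintegral_congr_ae h', lintegral_finsetSum _ fun j _ =>
    ((G j).measurable_coe hs).const_mul _]
  simp_rw [lintegral_const_mul _ ((G _).measurable_coe hs)]

open ProbabilityTheory in
lemma prod_apply_eq_sum_smul {X Y Z J : Type*} [MeasurableSpace X] [MeasurableSpace Y]
    [MeasurableSpace Z] [Fintype J] (K : Kernel X Z) [IsSFiniteKernel K] (P : Kernel X Y)
    [IsSFiniteKernel P] (c : J → ℝ≥0∞) (G : J → Kernel X Z) [∀ j, IsSFiniteKernel (G j)] {x : X}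
    (h : K x = ∑ j, c j • G j x) :
    (K ×ₖ P) x = ∑ j, c j • (G j ×ₖ P) x := by
  ext s hs
  rw [Kernel.prod_apply, h, Measure.finsetSum_apply]
  simp only [Measure.smul_apply, smul_eq_mul, Kernel.prod_apply]
  rw [Measure.prod_apply hs, ← Measure.sum_fintype, lintegral_sum_measure, tsum_fintype]
  simp only [lintegral_smul_measure, smul_eq_mul, Measure.prod_apply hs]

open ProbabilityTheory in
/-- a flow update with gluing edge candidates does not increase the entropic
objective: `KL(π̂ | μ⊗ν) ≤ KL(π | μ⊗ν)`. -/
theorem flow_update_entropy_nonincreasing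
    {X Y : Type*} [MetricSpace X] [CompactSpace X] [MeasurableSpace X] [BorelSpace X]
    [MetricSpace Y] [CompactSpace Y] [MeasurableSpace Y] [BorelSpace Y]
    {I : Type*} [Fintype I] [DecidableEq I]
    (μ : Measure X) (ν : Measure Y) [IsProbabilityMeasure μ] [IsProbabilityMeasure ν]
    (π : Measure (X × Y)) (hπ : IsCoupling μ ν π)
    (Xpart : I → Set X) (hclosed : ∀ i, IsClosed (Xpart i))
    (hcover : ⋃ i, Xpart i = Set.univ)
    (hdisj : ∀ i j, i ≠ j → μ (Xpart i ∩ Xpart j) = 0)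
    (hm : ∀ i, 0 < μ (Xpart i))
    (N : Finset (I × I)) (hNrefl : ∀ i, (i, i) ∈ N)
    (hNsymm : ∀ i j, (i, j) ∈ N → (j, i) ∈ N)
    (w : I → I → ℝ) (hw_nonneg : ∀ i j, 0 ≤ w i j)
    (hw_supp : ∀ i j, (i, j) ∉ N → w i j = 0)
    (hdiv_out : ∀ i, ∑ j, w i j = (μ (Xpart i)).toReal)
    (hdiv_in : ∀ i, ∑ j, w j i = (μ (Xpart i)).toReal)
    -- disintegration kernels of the couplings γ_{ij} ∈ Π(μ_i/m_i, μ_j/m_j)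
    (γk : I → I → X → Measure X) (hγk_meas : ∀ i j, Measurable (γk i j))
    (hγk_prob : ∀ i j x, IsProbabilityMeasure (γk i j x))
    (hγ_marg : ∀ i j, (i, j) ∈ N → i ≠ j →
      (((μ (Xpart i))⁻¹ • μ.restrict (Xpart i)).bind
          (fun x => (Measure.dirac x).prod (γk i j x))).map Prod.snd
        = (μ (Xpart j))⁻¹ • μ.restrict (Xpart j))
    -- disintegration kernels of the cell plans π_i with respect to μ_i
    (πk : I → X → Measure Y) (hπk_meas : ∀ i, Measurable (πk i))
    (hπk_prob : ∀ i x, IsProbabilityMeasure (πk i x))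
    (hπ_disint : ∀ i, π.restrict (Xpart i ×ˢ Set.univ)
      = (μ.restrict (Xpart i)).bind (fun x => (Measure.dirac x).prod (πk i x))) :
    KL (∑ e ∈ N, ENNReal.ofReal (w e.1 e.2) • gluingPihat μ π Xpart γk πk e.1 e.2)
        (μ.prod ν)
      ≤ KL π (μ.prod ν) := by
  have hXm : ∀ i, MeasurableSet (Xpart i) := fun i => (hclosed i).measurableSet
  have hm0 : ∀ i, μ (Xpart i) ≠ 0 := fun i => (hm i).ne'
  have hmt : ∀ i, μ (Xpart i) ≠ ∞ := fun i => measure_ne_top _ _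
  have : IsProbabilityMeasure π := by
    constructor
    rw [← Set.preimage_univ (f := Prod.fst), ← Measure.map_apply measurable_fst .univ, hπ.1]
    exact measure_univ
  set c : I → I → ℝ≥0∞ := fun i j => ENNReal.ofReal (w i j) * (μ (Xpart i))⁻¹ with hc
  have hw_out : ∀ i, ∑ j, ENNReal.ofReal (w i j) = μ (Xpart i) := fun i => by
    rw [← ENNReal.ofReal_sum_of_nonneg fun j _ => hw_nonneg i j, hdiv_out,
      ENNReal.ofReal_toReal (hmt i)]
  have hw_in : ∀ j, ∑ i, ENNReal.ofReal (w i j) = μ (Xpart j) := fun j => by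
    rw [← ENNReal.ofReal_sum_of_nonneg fun i _ => hw_nonneg i j, hdiv_in,
      ENNReal.ofReal_toReal (hmt j)]
  have hc_sum : ∀ i, ∑ j, c i j = 1 := fun i => by
    rw [← Finset.sum_mul, hw_out, ENNReal.mul_inv_cancel (hm0 i) (hmt i)]
  let G : I → I → Kernel X X := fun i j =>
    if i = j then Kernel.id else ⟨γk i j, hγk_meas i j⟩
  have hG_diag : ∀ i, G i i = Kernel.id := fun i => if_pos rfl
  have hG_off : ∀ i j, i ≠ j → G i j = ⟨γk i j, hγk_meas i j⟩ := fun i j h => if_neg h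
  have hG : ∀ i j, IsMarkovKernel (G i j) := by
    intro i j
    by_cases h : i = j
    · subst h
      rw [hG_diag]
      infer_instance
    · rw [hG_off i j h]
      exact ⟨fun x => hγk_prob i j x⟩
  let P : I → Kernel X Y := fun i => ⟨πk i, hπk_meas i⟩
  have hP : ∀ i, IsMarkovKernel (P i) := fun i => ⟨fun x => hπk_prob i x⟩
  obtain ⟨K, hK, hKk⟩ := exists_isMarkovKernel_ae_eq_restrict μ Xpart hXm hdisj
    (fun i x => ∑ j, c i j • G i j x)
    (fun i => Measure.measurable_of_measurable_coe _ fun s hs => by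
      simp only [Measure.finsetSum_apply, Measure.smul_apply, smul_eq_mul]
      exact Finset.measurable_fun_sum _ fun j _ => ((G i j).measurable_coe hs).const_mul _)
    (fun i x => ⟨by simp [Measure.finsetSum_apply, hc_sum]⟩) Kernel.id
  have hμ_sum : μ = ∑ i, μ.restrict (Xpart i) := by
    rw [← Measure.sum_fintype, ← Measure.restrict_iUnion_ae (fun i j h => hdisj i j h)
      fun i => (hXm i).nullMeasurableSet, hcover, Measure.restrict_univ]
  have hπ_sum : π = ∑ i, π.restrict (Xpart i ×ˢ Set.univ) := by
    rw [← Measure.sum_fintype, ← Measure.restrict_iUnion_ae _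
      fun i => ((hXm i).prod MeasurableSet.univ).nullMeasurableSet, ← Set.iUnion_prod_const,
      hcover, Set.univ_prod_univ, Measure.restrict_univ]
    intro i j h
    change π _ = 0
    rw [Set.prod_inter_prod, Set.univ_inter, Set.prod_univ,
      ← Measure.map_apply measurable_fst ((hXm i).inter (hXm j)), hπ.1]
    exact hdisj i j h
  have hKμ : μ.bind K = μ := by
    have hGμ : ∀ i j, c i j • (μ.restrict (Xpart i)).bind (G i j)
        = (ENNReal.ofReal (w i j) * (μ (Xpart j))⁻¹) • μ.restrict (Xpart j) := by
      intro i j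
      by_cases h : i = j
      · subst h
        rw [hG_diag, Measure.id_comp]
      · by_cases hN : (i, j) ∈ N
        · have hmarg := hγ_marg i j hN h
          have hprod : (fun x => (Measure.dirac x).prod (γk i j x)) = (Kernel.id ×ₖ G i j) := by
            funext x
            rw [Kernel.prod_apply, Kernel.id_apply, hG_off i j h]
            rfl
          rw [hprod, ← Measure.compProd_eq_comp_prod, ← Measure.snd, Measure.snd_compProd,
            Measure.comp_smul] at hmarg
          simp only [hc, mul_smul, hmarg]
        · simp [hc, hw_supp i j hN]
    conv_lhs => rw [hμ_sum]
    rw [← Measure.sum_fintype, Measure.bind_sum _ _ K.aemeasurable, Measure.sum_fintype]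
    simp_rw [comp_eq_sum_smul_comp _ K _ _ (hKk _), hGμ]
    rw [Finset.sum_comm]
    simp_rw [← Finset.sum_smul, ← Finset.sum_mul, hw_in,
      ENNReal.mul_inv_cancel (hm0 _) (hmt _), one_smul]
    exact hμ_sum.symm
  have hσ : (K ∥ₖ Kernel.id) ∘ₘ (μ.prod ν) = μ.prod ν := by
    rw [← Measure.prod_comp_left, hKμ]
  have hcell : ∀ i, π.restrict (Xpart i ×ˢ Set.univ)
      = (Kernel.id ×ₖ P i) ∘ₘ μ.restrict (Xpart i) := by
    intro i
    rw [hπ_disint i]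
    congr 1
    funext x
    rw [Kernel.prod_apply, Kernel.id_apply]
    rfl
  have hpihat : ∀ i j, gluingPihat μ π Xpart γk πk i j
      = (μ (Xpart i))⁻¹ • ((G i j ×ₖ P i) ∘ₘ μ.restrict (Xpart i)) := by
    intro i j
    rw [gluingPihat]
    split_ifs with h
    · subst h
      rw [hG_diag, hcell]
    · congr 2
      funext x
      rw [Kernel.prod_apply, hG_off i j h]
      rfl
  have hKπ : (K ∥ₖ Kernel.id) ∘ₘ π
      = ∑ e ∈ N, ENNReal.ofReal (w e.1 e.2) • gluingPihat μ π Xpart γk πk e.1 e.2 := by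
    conv_lhs => rw [hπ_sum]
    rw [← Measure.sum_fintype, Measure.bind_sum _ _ (Kernel.aemeasurable _), Measure.sum_fintype]
    simp_rw [hcell, Measure.comp_assoc, Kernel.parallelComp_comp_prod, Kernel.comp_id,
      Kernel.id_comp]
    have hKP : ∀ i, (K ×ₖ P i) ∘ₘ μ.restrict (Xpart i)
        = ∑ j, c i j • ((G i j ×ₖ P i) ∘ₘ μ.restrict (Xpart i)) := fun i =>
      comp_eq_sum_smul_comp _ _ _ _ <| (hKk i).mono fun x hx =>
        prod_apply_eq_sum_smul K (P i) (c i) (G i) hx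
    simp_rw [hKP, hpihat, smul_smul]
    rw [← Fintype.sum_prod_type']
    refine (Finset.sum_subset (Finset.subset_univ N) fun e _ he => ?_).symm
    simp [hc, hw_supp e.1 e.2 he]
  rw [← hKπ, KL_eq_klDiv, KL_eq_klDiv]
  conv_lhs => rw [← hσ]
  exact InformationTheory.klDiv_comp_right_le π (μ.prod ν) (K ∥ₖ Kernel.id)
end
end
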